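/- Suppose Assumption A3 holds, f : ℝ × ℝ → ℝ is nondecreasing in its first argument, and for each d ∈ {d_1,…,d_M} and z ∈ Z there exists a vector x^{d,z} ∈ X such that x^{d,z} ⪯ λ(d,z,x) for every x ∈ X with σ(d,z,x) ≠ 0, and f(s*(e_N), d) ≤ s*(x^{d,z}). Then Assumption A1 holds: f(s*(x), d) ≤ s*(λ(d,z,x)) for every x ∈ X, every d ∈ {d_1,…,d_M}, and every z ∈ Z with σ(d,z,x) ≠ 0. -/

import Mathlib

open Finset

noncomputable section

open scoped Classical

namespace InvCtrl

variable {N M : ℕ} {Z : Type*}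

/-- Membership in the belief space `X ⊆ ℝ^N`. -/
def memX (N : ℕ) (x : Fin N → ℝ) : Prop :=
  (∀ i, 0 ≤ x i) ∧ ∑ i, x i = 1

variable [Fintype Z]

/-- `σ(d_k, z, x) = x ⬝ P(d_k, z) ⬝ 𝟙`. -/
def sigz (P : Fin M → Z → Matrix (Fin N) (Fin N) ℝ) (k : Fin M) (z : Z) (x : Fin N → ℝ) : ℝ :=
  ∑ i, x i * ∑ j, P k z i j

/-- `σ(d_k, x) = ∑_z σ(d_k, z, x)`. -/
def sig (P : Fin M → Z → Matrix (Fin N) (Fin N) ℝ) (k : Fin M) (x : Fin N → ℝ) : ℝ :=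
  ∑ z, sigz P k z x

/-- Posterior belief `λ(d_k, z, x) = x P(d_k, z) / σ(d_k, z, x)` (componentwise). -/
def lam (P : Fin M → Z → Matrix (Fin N) (Fin N) ℝ) (k : Fin M) (z : Z) (x : Fin N → ℝ) :
    Fin N → ℝ :=
  fun j => (∑ i, x i * P k z i j) / sigz P k z x

/-- Single-period cost `c(y, d) = p·(d − y)⁺ + h·(y − d)⁺`. -/
def cst (p hc y dd : ℝ) : ℝ := p * max (dd - y) 0 + hc * max (y - dd) 0

/-- Expected single-period cost `L(x, y) = ∑_k σ(d_k, x) c(y, d_k)`. -/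
def Lf (P : Fin M → Z → Matrix (Fin N) (Fin N) ℝ) (d : Fin M → ℤ) (p hc : ℝ)
    (x : Fin N → ℝ) (y : ℝ) : ℝ :=
  ∑ k, sig P k x * cst p hc y (d k : ℝ)

/-- `s*(x)`: the smallest element of `{d_1, …, d_M}` at which `m ↦ L(x, d_m)` is minimized. -/
def sStar (P : Fin M → Z → Matrix (Fin N) (Fin N) ℝ) (d : Fin M → ℤ) (p hc : ℝ)
    (x : Fin N → ℝ) : ℤ :=
  sInf {t : ℤ | ∃ m : Fin M, t = d m ∧ ∀ k : Fin M, Lf P d p hc x (d m : ℝ) ≤ Lf P d p hc x (d k : ℝ)}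

/-- First-order stochastic dominance `x ⪯ x'`. -/
def sdom (x x' : Fin N → ℝ) : Prop :=
  ∀ n : Fin N, ∑ i ∈ univ.filter (fun i => n ≤ i), x i ≤ ∑ i ∈ univ.filter (fun i => n ≤ i), x' i

/-- The `i`-th standard unit vector in `ℝ^N`. -/
def eV (N : ℕ) (i : Fin N) : Fin N → ℝ := fun j => if j = i then 1 else 0

/-- Assumption A3. -/
def A3 (P : Fin M → Z → Matrix (Fin N) (Fin N) ℝ) : Prop :=
  ∀ i i' : Fin N, i ≤ i' → ∀ m : Fin M,
    ∑ k ∈ univ.filter (fun k : Fin M => m ≤ k), ∑ j, ∑ z, P k z i j ≤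
      ∑ k ∈ univ.filter (fun k : Fin M => m ≤ k), ∑ j, ∑ z, P k z i' j

/-- `A_m(x) = h ∑_{k=1}^m σ(d_k,x) − p ∑_{k=m+1}^M σ(d_k,x)` (for `m = 0, …, M`). -/
def Am (P : Fin M → Z → Matrix (Fin N) (Fin N) ℝ) (p hc : ℝ) (m : ℕ) (x : Fin N → ℝ) : ℝ :=
  hc * ∑ k ∈ univ.filter (fun k : Fin M => (k : ℕ) < m), sig P k x
    - p * ∑ k ∈ univ.filter (fun k : Fin M => m ≤ (k : ℕ)), sig P k x

/-- `B_m(x) = p ∑_{k=m+1}^M d_k σ(d_k,x) − h ∑_{k=1}^m d_k σ(d_k,x)` (for `m = 0, …, M`). -/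
def Bm (P : Fin M → Z → Matrix (Fin N) (Fin N) ℝ) (d : Fin M → ℤ) (p hc : ℝ) (m : ℕ)
    (x : Fin N → ℝ) : ℝ :=
  p * ∑ k ∈ univ.filter (fun k : Fin M => m ≤ (k : ℕ)), (d k : ℝ) * sig P k x
    - hc * ∑ k ∈ univ.filter (fun k : Fin M => (k : ℕ) < m), (d k : ℝ) * sig P k x

theorem tail_nonneg_sum (n : ℕ) : ∀ (w g : Fin n → ℝ), Monotone g → (∀ i, 0 ≤ g i) →
    (∀ m : Fin n, 0 ≤ ∑ i ∈ univ.filter (fun i => m ≤ i), w i) → 0 ≤ ∑ i, w i * g i := by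
  induction n with
  | zero => intro w g _ _ _; simp
  | succ n ih =>
    intro w g hg h0 ht
    have h1 := ih (fun i => w i.succ) (fun i => g i.succ - g 0)
      (fun a b hab => by
        have := hg (Fin.succ_le_succ_iff.mpr hab)
        simpa using this)
      (fun i => sub_nonneg.mpr (hg (Fin.zero_le _)))
      (fun m => by
        have := ht m.succ
        rw [sum_filter, Fin.sum_univ_succ] at this
        rw [sum_filter]
        simpa [Fin.succ_le_succ_iff] using this)
    have h2 := ht 0
    rw [filter_true_of_mem (fun i _ => Fin.zero_le i)] at h2
    have h3 := mul_nonneg (h0 0) h2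
    rw [Fin.sum_univ_succ] at h3 ⊢
    simp only [mul_sub, sum_sub_distrib, ← sum_mul] at h1
    nlinarith

theorem fosd {n : ℕ} (u v g : Fin n → ℝ) (hg : Monotone g) (hs : ∑ i, u i = ∑ i, v i)
    (ht : sdom u v) : ∑ i, u i * g i ≤ ∑ i, v i * g i := by
  rcases n with _ | n
  · simp
  have h := tail_nonneg_sum (n + 1) (fun i => v i - u i) (fun i => g i - g 0)
    (fun a b hab => by have := hg hab; simpa using this)
    (fun i => sub_nonneg.mpr (hg (Fin.zero_le _)))
    (fun m => by
      rw [sum_sub_distrib]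
      exact sub_nonneg.mpr (ht m))
  simp only [mul_sub, sub_mul, sum_sub_distrib, ← sum_mul] at h
  rw [hs] at h
  linarith

theorem cst_mono {p hc a b s t : ℝ} (hp : 0 < p) (hh : 0 < hc) (hab : a ≤ b) (hst : s ≤ t) :
    cst p hc a s - cst p hc b s ≤ cst p hc a t - cst p hc b t := by
  have h1 : max (s - a) 0 - max (s - b) 0 ≤ max (t - a) 0 - max (t - b) 0 := by
    grind
  have h2 : max (a - s) 0 - max (b - s) 0 ≤ max (a - t) 0 - max (b - t) 0 := by
    grind
  unfold cst
  have := mul_le_mul_of_nonneg_left h1 hp.le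
  have := mul_le_mul_of_nonneg_left h2 hh.le
  linarith

theorem sig_eq (P : Fin M → Z → Matrix (Fin N) (Fin N) ℝ) (s : Finset (Fin M)) (x : Fin N → ℝ) :
    ∑ k ∈ s, sig P k x = ∑ i, x i * ∑ k ∈ s, ∑ j, ∑ z, P k z i j := by
  simp only [sig, sigz, mul_sum]
  rw [sum_congr rfl (fun k _ => sum_comm), sum_comm]
  exact sum_congr rfl fun i _ => sum_congr rfl fun k _ => sum_comm

theorem sStar_spec (hM : 1 ≤ M) (P : Fin M → Z → Matrix (Fin N) (Fin N) ℝ) (d : Fin M → ℤ)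
    (p hc : ℝ) (x : Fin N → ℝ) :
    (∃ m : Fin M, sStar P d p hc x = d m ∧
      ∀ k : Fin M, Lf P d p hc x (d m : ℝ) ≤ Lf P d p hc x (d k : ℝ)) ∧
    ∀ m : Fin M, (∀ k : Fin M, Lf P d p hc x (d m : ℝ) ≤ Lf P d p hc x (d k : ℝ)) →
      sStar P d p hc x ≤ d m := by
  have : Nonempty (Fin M) := ⟨⟨0, hM⟩⟩
  have hb : BddBelow {t : ℤ | ∃ m : Fin M, t = d m ∧
      ∀ k : Fin M, Lf P d p hc x (d m : ℝ) ≤ Lf P d p hc x (d k : ℝ)} := by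
    apply ((Set.finite_range d).subset _).bddBelow
    rintro t ⟨m, rfl, _⟩
    exact ⟨m, rfl⟩
  obtain ⟨m, hm⟩ := Finite.exists_min (fun m => Lf P d p hc x (d m : ℝ))
  have hne : {t : ℤ | ∃ m : Fin M, t = d m ∧
      ∀ k : Fin M, Lf P d p hc x (d m : ℝ) ≤ Lf P d p hc x (d k : ℝ)}.Nonempty :=
    ⟨d m, m, rfl, hm⟩
  exact ⟨Int.csInf_mem hne hb, fun m' hm' => csInf_le hb ⟨m', rfl, hm'⟩⟩

theorem sStar_mono (hM : 1 ≤ M) (d : Fin M → ℤ) (hd : StrictMono d)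
    (P : Fin M → Z → Matrix (Fin N) (Fin N) ℝ)
    (hPst : ∀ i : Fin N, ∑ k : Fin M, ∑ z : Z, ∑ j : Fin N, P k z i j = 1)
    (p hc : ℝ) (hp : 0 < p) (hhc : 0 < hc) (hA3 : A3 P)
    (x y : Fin N → ℝ) (hx : memX N x) (hy : memX N y) (hxy : sdom x y) :
    sStar P d p hc x ≤ sStar P d p hc y := by
  obtain ⟨⟨m, hm, hmin⟩, hle⟩ := sStar_spec hM P d p hc x
  obtain ⟨⟨m', hm', hmin'⟩, -⟩ := sStar_spec hM P d p hc y
  by_contra! hlt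
  have hstrict : Lf P d p hc x (d m) < Lf P d p hc x (d m') := by
    by_contra! hcon
    have := hle m' (fun k => hcon.trans (hmin k))
    omega
  have hdd : (d m' : ℝ) ≤ d m := by exact_mod_cast (by omega : d m' ≤ d m)
  have htot : ∀ x, memX N x → ∑ k, sig P k x = 1 := by
    intro x hx
    rw [sig_eq, ← hx.2]
    refine sum_congr rfl fun i _ => ?_
    rw [sum_congr rfl (fun k _ => sum_comm), hPst, mul_one]
  have hdom : sdom (fun k => sig P k x) (fun k => sig P k y) := by
    intro n
    simp only [sig_eq]
    exact fosd x y _ (fun i i' hi => hA3 i i' hi n) (hx.2.trans hy.2.symm) hxy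
  have key := fosd (fun k => sig P k x) (fun k => sig P k y)
    (fun k => cst p hc (d m') (d k) - cst p hc (d m) (d k))
    (fun k k' hk => cst_mono hp hhc hdd (by exact_mod_cast hd.monotone hk))
    ((htot x hx).trans (htot y hy).symm) hdom
  simp only [mul_sub, sum_sub_distrib] at key
  have h3 := hmin' m
  unfold Lf at hstrict h3
  linarith

theorem lam_mem (P : Fin M → Z → Matrix (Fin N) (Fin N) ℝ)
    (hPnn : ∀ k z i j, 0 ≤ P k z i j) (k : Fin M) (z : Z) (x : Fin N → ℝ) (hx : memX N x)
    (h : sigz P k z x ≠ 0) : memX N (lam P k z x) := by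
  constructor
  · intro j
    refine div_nonneg (sum_nonneg fun i _ => mul_nonneg (hx.1 i) (hPnn _ _ _ _)) ?_
    exact sum_nonneg fun i _ => mul_nonneg (hx.1 i) (sum_nonneg fun j _ => hPnn _ _ _ _)
  · unfold lam
    rw [← sum_div, sum_comm]
    simp only [← mul_sum]
    exact div_self h

theorem eV_mem (i : Fin N) : memX N (eV N i) := by
  constructor
  · intro j; unfold eV; split_ifs <;> norm_num
  · simp [eV]

theorem sdom_eV (hN : 1 ≤ N) (x : Fin N → ℝ) (hx : memX N x) :
    sdom x (eV N ⟨N - 1, by omega⟩) := by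
  intro n
  have h1 : ∑ i ∈ univ.filter (fun i => n ≤ i), eV N ⟨N - 1, by omega⟩ i = 1 := by
    unfold eV
    rw [sum_ite_eq', if_pos]
    simp only [mem_filter, mem_univ, true_and, Fin.le_def]
    omega
  rw [h1, ← hx.2]
  exact sum_le_sum_of_subset_of_nonneg (filter_subset _ _) fun i _ _ => hx.1 i

/-- Lemma 6: Assumption A3, monotonicity of `f` in its first argument,
and Assumption A4 (existence of the dominated vectors `x^{d,z}`) together imply
Assumption A1. -/
theorem stmt3 {N M : ℕ} {Z : Type*} [Fintype Z] [Nonempty Z]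
    (hN : 1 ≤ N) (hM : 1 ≤ M)
    (d : Fin M → ℤ) (hd : StrictMono d)
    (P : Fin M → Z → Matrix (Fin N) (Fin N) ℝ)
    (hPnn : ∀ k z i j, 0 ≤ P k z i j)
    (hPst : ∀ i : Fin N, ∑ k : Fin M, ∑ z : Z, ∑ j : Fin N, P k z i j = 1)
    (p hc : ℝ) (hp : 0 < p) (hhc : 0 < hc)
    (hA3 : A3 P)
    (f : ℝ → ℝ → ℝ) (hf : ∀ dd : ℝ, Monotone fun y => f y dd)
    (hA4 : ∀ (k : Fin M) (z : Z), ∃ xv : Fin N → ℝ, memX N xv ∧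
      (∀ x : Fin N → ℝ, memX N x → sigz P k z x ≠ 0 → sdom xv (lam P k z x)) ∧
      f (sStar P d p hc (eV N ⟨N - 1, by omega⟩) : ℝ) (d k : ℝ) ≤ (sStar P d p hc xv : ℝ)) :
    ∀ x : Fin N → ℝ, memX N x → ∀ (k : Fin M) (z : Z), sigz P k z x ≠ 0 →
      f (sStar P d p hc x : ℝ) (d k : ℝ) ≤ (sStar P d p hc (lam P k z x) : ℝ) := by
  intro x hx k z hs
  obtain ⟨xv, hxv, hdom, hle⟩ := hA4 k z
  have h1 := sStar_mono hM d hd P hPst p hc hp hhc hA3 x _ hx (eV_mem _) (sdom_eV hN x hx)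
  have h2 := sStar_mono hM d hd P hPst p hc hp hhc hA3 xv _ hxv
    (lam_mem P hPnn k z x hx hs) (hdom x hx hs)
  exact (hf (d k) (Int.cast_le.mpr h1)).trans (hle.trans (Int.cast_le.mpr h2))

end InvCtrl
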